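/- Let (X, h, Z) be a fiberwise essentially minimal zero-dimensional system with associated map ψ : X → Z, and let f : X → ℤ be continuous. Then f ∘ h⁻¹ = f if and only if f is constant on the fiber ψ⁻¹(z) for every z ∈ Z. -/

import Mathlib

open Set

/-- A minimal set for the restriction of the homeomorphism `h` to the invariant set `A`:
a nonempty closed `h`-invariant subset of `A` with no nonempty proper closed
`h`-invariant subset. -/
def IsMinimalSubsetOf {X : Type*} [TopologicalSpace X] (h : X ≃ₜ X) (A Y : Set X) : Prop :=
  Y.Nonempty ∧ IsClosed Y ∧ Y ⊆ A ∧ h '' Y = Y ∧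
    ∀ Y' ⊆ Y, Y'.Nonempty → IsClosed Y' → h '' Y' = Y' → Y' = Y

/-- `(X, h, Z)` is a fiberwise essentially minimal zero-dimensional system with
associated map `ψ`. -/
def IsFiberwiseEssentiallyMinimal {X : Type*} [TopologicalSpace X] (h : X ≃ₜ X)
    (Z : Set X) (ψ : X → X) : Prop :=
  IsClosed Z ∧ Continuous ψ ∧ (∀ x, ψ x ∈ Z) ∧ (∀ z ∈ Z, ψ z = z) ∧
    (∀ x, ψ (h x) = ψ x) ∧
    ∀ z ∈ Z, ∃ Y, IsMinimalSubsetOf h (ψ ⁻¹' {z}) Y ∧ z ∈ Y ∧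
      ∀ Y', IsMinimalSubsetOf h (ψ ⁻¹' {z}) Y' → Y' = Y

/-- Every nonempty closed invariant set of a homeomorphism of a compact space contains a
minimal set. -/
theorem exists_isMinimalSubsetOf {X : Type*} [TopologicalSpace X] [CompactSpace X]
    (h : X ≃ₜ X) {A : Set X} (hne : A.Nonempty) (hcl : IsClosed A) (hinv : h '' A = A) :
    ∃ Y, IsMinimalSubsetOf h A Y := by
  obtain ⟨Y, hYA, hY⟩ := zorn_superset_nonempty
    {B : Set X | B.Nonempty ∧ IsClosed B ∧ h '' B = B} (by
      intro c hc hchain hcne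
      have : Nonempty c := hcne.to_subtype
      refine ⟨⋂₀ c, ⟨?_, isClosed_sInter fun s hs => (hc hs).2.1, ?_⟩,
        fun s hs => sInter_subset_of_mem hs⟩
      · exact IsCompact.nonempty_sInter_of_directed_nonempty_isCompact_isClosed
          (fun s hs t ht => (hchain.total hs ht).elim (fun hst => ⟨s, hs, subset_rfl, hst⟩)
            fun hts => ⟨t, ht, hts, subset_rfl⟩) (fun s hs => (hc hs).1)
          (fun s hs => (hc hs).2.1.isCompact) (fun s hs => (hc hs).2.1)
      · rw [sInter_eq_iInter, image_iInter h.bijective]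
        exact iInter_congr fun s => (hc s.2).2.2) A ⟨hne, hcl, hinv⟩
  exact ⟨Y, hY.prop.1, hY.prop.2.1, hYA, hY.prop.2.2,
    fun Y' hsub h1 h2 h3 => hsub.antisymm (hY.le_of_le ⟨h1, h2, h3⟩ hsub)⟩

/-- The image of a set under a homeomorphism is the set itself if membership is preserved in both
directions. -/
theorem Homeomorph.image_eq_self_of_mem_iff {X : Type*} [TopologicalSpace X] (h : X ≃ₜ X)
    {A : Set X} (hA : ∀ x, h x ∈ A ↔ x ∈ A) : h '' A = A := by
  ext x
  obtain ⟨y, rfl⟩ := h.surjective x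
  rw [h.injective.mem_set_image, hA]

/-- For a fiberwise essentially minimal zero-dimensional system, a continuous `ℤ`-valued
function satisfies `f ∘ h⁻¹ = f` iff it is constant on every fiber of `ψ`. -/
theorem stmt4 {X : Type*} [TopologicalSpace X] [CompactSpace X]
    [TopologicalSpace.MetrizableSpace X] [TotallyDisconnectedSpace X]
    (h : X ≃ₜ X) (Z : Set X) (ψ : X → X)
    (hfem : IsFiberwiseEssentiallyMinimal h Z ψ)
    (f : X → ℤ) (hf : Continuous f) :
    (f ∘ h.symm = f) ↔
      ∀ z ∈ Z, ∀ x ∈ ψ ⁻¹' {z}, ∀ y ∈ ψ ⁻¹' {z}, f x = f y := by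
  obtain ⟨-, hψ, hψZ, -, hψh, hmin⟩ := hfem
  constructor
  · intro hfh
    have hinv : ∀ x, f (h x) = f x := fun x => by
      simpa using (congrFun hfh (h x)).symm
    have key : ∀ z ∈ Z, ∀ x ∈ ψ ⁻¹' {z}, f x = f z := by
      intro z hz x hx
      obtain ⟨Y, -, hzY, huniq⟩ := hmin z hz
      have : T1Space X := by
        let _ := TopologicalSpace.metrizableSpaceMetric X
        infer_instance
      obtain ⟨Y', hne, hcl, hsub, hY'⟩ := exists_isMinimalSubsetOf h
        (A := ψ ⁻¹' {z} ∩ f ⁻¹' {f x}) ⟨x, hx, rfl⟩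
        ((isClosed_singleton.preimage hψ).inter (isClosed_singleton.preimage hf))
        (h.image_eq_self_of_mem_iff fun y => by simp [hψh, hinv])
      have hYY := huniq Y' ⟨hne, hcl, hsub.trans inter_subset_left, hY'⟩
      exact (hsub (hYY ▸ hzY)).2.symm
    exact fun z hz x hx y hy => (key z hz x hx).trans (key z hz y hy).symm
  · intro hconst
    funext x
    refine hconst (ψ x) (hψZ x) _ ?_ _ rfl
    simpa using (hψh (h.symm x)).symm
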